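/- Let ρ = β + iγ run over the non-trivial zeros of the Riemann zeta function, let z = a + iy with a ∈ (0,1) and y ∈ ℝ, and let α > 1. Then ∑_ρ |γ|^{β−1/2}·∫_{Y₁∪Y₂} exp(γ·arctan(y/a) − (π/2)|γ|)·|z|^{−α−β} dy ≪_α a^{−α}, where Y₁ = {y ∈ ℝ : γy ≤ 0} and Y₂ = {y ∈ [−a,a] : γy > 0}. The result remains true if a factor log^c(|y|/a), for any fixed c ≥ 0, is inserted in the integrand. -/

import Mathlib

open Complex

noncomputable section

/-- The non-trivial zeros of the Riemann zeta function. -/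
def zetaZeros : Set ℂ := {ρ | riemannZeta ρ = 0 ∧ 0 < ρ.re ∧ ρ.re < 1}

/-- `Y₁ = {y : γ y ≤ 0}` for a zero with imaginary part `γ`. -/
def Y1 (γ : ℝ) : Set ℝ := {y | γ * y ≤ 0}

/-- `Y₂ = {y ∈ [-a,a] : γ y > 0}`. -/
def Y2 (γ a : ℝ) : Set ℝ := {y ∈ Set.Icc (-a) a | 0 < y * γ}

section

open MeasureTheory

open Classical in
theorem AnalyticOnNhd.card_zeros_le {c : ℂ} {r R M : ℝ} {f : ℂ → ℂ} (hr : 0 < r) (hrR : r < R)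
    (hM : 1 ≤ M) (hf : AnalyticOnNhd ℂ f (Metric.closedBall c R)) (hfc : f c ≠ 0)
    (hbound : ∀ z ∈ Metric.sphere c R, ‖f z‖ ≤ M) (T : Finset ℂ)
    (hT : ∀ z ∈ T, z ∈ Metric.closedBall c r ∧ f z = 0) :
    (T.card : ℝ) ≤ Real.log (M / ‖f c‖) / Real.log (R / r) := by
  have hR : 0 < R := hr.trans hrR
  have key := AnalyticOnNhd.sum_divisor_le (c := c) (r := r) (R := R) (M := M) (f := f)
    (abs_pos.2 hr.ne') (by rwa [abs_of_pos hr, abs_of_pos hR]) hM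
    (by rwa [abs_of_pos hR]) hfc (by rwa [abs_of_pos hR])
  refine le_trans ?_ key
  rw [abs_of_pos hr]
  have hf' : AnalyticOnNhd ℂ f (Metric.closedBall c r) :=
    hf.mono (Metric.closedBall_subset_closedBall hrR.le)
  have hD := (MeromorphicOn.divisor f (Metric.closedBall c r)).finiteSupport
    (isCompact_closedBall c r)
  have hnn : ∀ u, 0 ≤ MeromorphicOn.divisor f (Metric.closedBall c r) u := fun u =>
    (MeromorphicOn.AnalyticOnNhd.divisor_nonneg hf') u
  have hone : ∀ u ∈ T, 1 ≤ MeromorphicOn.divisor f (Metric.closedBall c r) u := by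
    intro u hu
    obtain ⟨hu1, hu2⟩ := hT u hu
    rw [MeromorphicOn.AnalyticOnNhd.divisor_apply hf' hu1]
    have hne : analyticOrderAt f u ≠ 0 := by
      rw [(hf' u hu1).analyticOrderAt_ne_zero]; exact hu2
    have htop : analyticOrderAt f u ≠ ⊤ := by
      have hpre : IsPreconnected (Metric.closedBall c r) :=
        (convex_closedBall c r).isPreconnected
      have hc : c ∈ Metric.closedBall c r := Metric.mem_closedBall_self hr.le
      have h0 : analyticOrderAt f c ≠ ⊤ := by
        rw [(hf' c hc).analyticOrderAt_eq_zero.mpr hfc]; simp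
      exact hf'.analyticOrderAt_ne_top_of_isPreconnected hpre hc hu1 h0
    lift analyticOrderAt f u to ℕ using htop with k
    simp at hne ⊢
    omega
  have : (T.card : ℤ) ≤ ∑ᶠ u, MeromorphicOn.divisor f (Metric.closedBall c r) u := by
    rw [finsum_eq_sum_of_support_subset (s := hD.toFinset ∪ T) _ (by
      intro u hu; simp; left; simpa using hu)]
    calc (T.card : ℤ) = ∑ u ∈ T, 1 := by simp
      _ ≤ ∑ u ∈ T, _ := Finset.sum_le_sum hone
      _ ≤ _ := Finset.sum_le_sum_of_subset_of_nonneg Finset.subset_union_right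
        (fun u _ _ => hnn u)
  exact_mod_cast this

theorem exists_norm_mellin_le {E : Type*} [NormedAddCommGroup E] [NormedSpace ℂ E] {f : ℝ → E}
    {σ₁ σ₂ : ℝ} (h₁ : MellinConvergent f σ₁) (h₂ : MellinConvergent f σ₂) :
    ∃ M, ∀ s : ℂ, σ₁ ≤ s.re → s.re ≤ σ₂ → ‖mellin f s‖ ≤ M := by
  have hnorm : ∀ s : ℂ, ∀ t ∈ Set.Ioi (0 : ℝ),
      ‖(t : ℂ) ^ (s - 1) • f t‖ = t ^ (s.re - 1) * ‖f t‖ := by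
    intro s t ht
    rw [norm_smul, norm_cpow_eq_rpow_re_of_pos ht]; simp
  refine ⟨∫ t in Set.Ioi (0 : ℝ), (‖(t : ℂ) ^ ((σ₁ : ℂ) - 1) • f t‖ +
    ‖(t : ℂ) ^ ((σ₂ : ℂ) - 1) • f t‖), fun s hs₁ hs₂ => ?_⟩
  refine MeasureTheory.norm_integral_le_of_norm_le (h₁.norm.add h₂.norm) ?_
  refine (MeasureTheory.ae_restrict_iff' measurableSet_Ioi).2 (Filter.Eventually.of_forall ?_)
  intro t ht
  rw [hnorm _ t ht, hnorm _ t ht, hnorm _ t ht, ← add_mul]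
  gcongr
  have ht' : 0 < t := ht
  rcases le_total t 1 with h | h
  · have := Real.rpow_le_rpow_of_exponent_ge ht' h (show (σ₁ : ℂ).re - 1 ≤ s.re - 1 by simpa)
    have := Real.rpow_nonneg ht'.le ((σ₂ : ℂ).re - 1)
    linarith
  · have := Real.rpow_le_rpow_of_exponent_le h (show s.re - 1 ≤ (σ₂ : ℂ).re - 1 by simpa)
    have := Real.rpow_nonneg ht'.le ((σ₁ : ℂ).re - 1)
    linarith

theorem exists_norm_completedRiemannZeta₀_le (σ₁ σ₂ : ℝ) :
    ∃ M, ∀ s : ℂ, σ₁ ≤ s.re → s.re ≤ σ₂ → ‖completedRiemannZeta₀ s‖ ≤ M := by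
  have hconv : ∀ s : ℂ, MellinConvergent (HurwitzZeta.hurwitzEvenFEPair 0).f_modif s := fun s =>
    ((HurwitzZeta.hurwitzEvenFEPair 0).isStrongFEPair_toStrongFEPair.hasMellin s).1
  obtain ⟨M, hM⟩ := exists_norm_mellin_le (hconv ((σ₁ / 2 : ℝ) : ℂ)) (hconv ((σ₂ / 2 : ℝ) : ℂ))
  refine ⟨M / 2, fun s h₁ h₂ => ?_⟩
  have := hM (s / 2) (by simpa using by linarith) (by simpa using by linarith)
  have e : completedRiemannZeta₀ s =
    mellin (HurwitzZeta.hurwitzEvenFEPair 0).f_modif (s / 2) / 2 := rfl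
  rw [e, norm_div]
  simpa using by linarith

theorem Complex.norm_sin_le_exp_abs_im (z : ℂ) : ‖Complex.sin z‖ ≤ Real.exp |z.im| := by
  rw [Complex.sin, norm_div, norm_mul]
  have h1 : ‖Complex.exp (-z * I)‖ ≤ Real.exp |z.im| := by
    rw [Complex.norm_exp]; simpa using le_abs_self _
  have h2 : ‖Complex.exp (z * I)‖ ≤ Real.exp |z.im| := by
    rw [Complex.norm_exp]; simpa using neg_le_abs _
  have := norm_sub_le (Complex.exp (-z * I)) (Complex.exp (z * I))
  simp at *
  linarith

theorem norm_Gamma_half_add_sq (u : ℝ) :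
    Real.pi * Real.exp (-(Real.pi * |u|)) ≤ ‖Complex.Gamma (1 / 2 + u * I)‖ ^ 2 := by
  have h := Complex.Gamma_mul_Gamma_one_sub (1 / 2 + u * I)
  have hc : 1 - (1 / 2 + u * I) = (starRingEnd ℂ) (1 / 2 + u * I) := by
    rw [show (1 / 2 : ℂ) = ((1 / 2 : ℝ) : ℂ) by push_cast; rfl]
    simp only [map_add, map_mul, conj_ofReal, conj_I]; push_cast; ring
  rw [hc, Complex.Gamma_conj] at h
  have h2 := congrArg norm h
  rw [norm_mul, Complex.norm_conj, ← sq, norm_div] at h2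
  have hs : ‖Complex.sin (Real.pi * (1 / 2 + u * I))‖ ≤ Real.exp (Real.pi * |u|) := by
    refine (Complex.norm_sin_le_exp_abs_im _).trans_eq ?_
    simp [abs_mul, abs_of_pos Real.pi_pos]
  have hne : ‖Complex.sin (Real.pi * (1 / 2 + u * I))‖ ≠ 0 := by
    intro h0
    rw [h0, div_zero] at h2
    have : Complex.Gamma (1 / 2 + u * I) ≠ 0 := Complex.Gamma_ne_zero_of_re_pos (by simp)
    simp_all
  rw [h2, Real.exp_neg, ← div_eq_mul_inv]
  have : ‖(Real.pi : ℂ)‖ = Real.pi := by simp [abs_of_pos Real.pi_pos]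
  rw [this]
  have hpos : 0 < ‖Complex.sin (Real.pi * (1 / 2 + u * I))‖ := by positivity
  have := Real.pi_pos
  gcongr

theorem exists_le_norm_Gammaℝ_three_add :
    ∃ k : ℝ, 0 < k ∧ ∀ t : ℝ, k * Real.exp (-|t|) ≤ ‖Gammaℝ (3 + t * I)‖ := by
  refine ⟨Real.pi ^ (-(3 / 2 : ℝ)) / 2, by positivity, fun t => ?_⟩
  have e : (3 + t * I : ℂ) / 2 = (1 / 2 + (t / 2 : ℝ) * I) + 1 := by push_cast; ring
  have hne : (1 / 2 + (t / 2 : ℝ) * I : ℂ) ≠ 0 := by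
    intro h; have := congrArg Complex.re h; simp at this
  have h := norm_Gamma_half_add_sq (t / 2)
  have h1 : Real.exp (-|t|) ≤ ‖Complex.Gamma (1 / 2 + (t / 2 : ℝ) * I)‖ := by
    refine le_of_sq_le_sq ?_ (norm_nonneg _)
    refine le_trans ?_ h
    rw [← Real.exp_nat_mul]
    have : Real.exp ((2 : ℕ) * -|t|) ≤ Real.exp (-(Real.pi * |t / 2|)) := by
      apply Real.exp_le_exp.2
      rw [abs_div]; simp
      nlinarith [Real.pi_le_four, abs_nonneg t]
    nlinarith [Real.pi_gt_three, Real.exp_pos (-(Real.pi * |t / 2|))]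
  have h2 : 1 / 2 ≤ ‖(1 / 2 + (t / 2 : ℝ) * I : ℂ)‖ := by
    refine le_trans ?_ (Complex.re_le_norm _); simp
  rw [Gammaℝ_def, e, Complex.Gamma_add_one _ hne, norm_mul, norm_mul,
    Complex.norm_cpow_eq_rpow_re_of_pos Real.pi_pos]
  have : (-(3 + t * I : ℂ) / 2).re = -(3 / 2 : ℝ) := by simp; ring
  rw [this, div_mul_eq_mul_div, mul_div_assoc]
  have := Real.exp_pos (-|t|)
  gcongr
  nlinarith

theorem exists_le_norm_riemannZeta_three_add :
    ∃ k : ℝ, 0 < k ∧ ∀ t : ℝ, k ≤ ‖riemannZeta (3 + t * I)‖ := by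
  refine ⟨2 - Real.pi ^ 2 / 6, by nlinarith [Real.pi_lt_d2, Real.pi_gt_three], fun t => ?_⟩
  rw [zeta_eq_tsum_one_div_nat_add_one_cpow (by simp)]
  have hz : HasSum (fun n : ℕ => 1 / ((n : ℝ) + 1) ^ 2) (Real.pi ^ 2 / 6) := by
    have := (hasSum_nat_add_iff' 1).2 hasSum_zeta_two
    simpa using this
  have hb : ∀ n : ℕ, ‖1 / ((n : ℂ) + 1) ^ (3 + t * I)‖ ≤ 1 / ((n : ℝ) + 1) ^ 2 := by
    intro n
    have : ((n : ℂ) + 1) = (((n : ℝ) + 1 : ℝ) : ℂ) := by push_cast; rfl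
    rw [this, norm_div, Complex.norm_cpow_eq_rpow_re_of_pos (by positivity)]
    have h3 : (3 + t * I : ℂ).re = (3 : ℕ) := by simp
    rw [h3, Real.rpow_natCast, norm_one]
    gcongr
    · linarith [n.cast_nonneg (α := ℝ)]
    · norm_num
  have hs := Summable.of_norm_bounded hz.summable hb
  rw [hs.tsum_eq_zero_add]
  have hz1 := (hasSum_nat_add_iff' 1).2 hz
  have hle : ‖∑' n : ℕ, 1 / (((n + 1 : ℕ) : ℂ) + 1) ^ (3 + t * I)‖ ≤
      Real.pi ^ 2 / 6 - 1 := by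
    refine (tsum_of_norm_bounded hz1 (fun n => hb (n + 1))).trans_eq (by simp)
  have := norm_sub_le_norm_add (1 / (((0 : ℕ) : ℂ) + 1) ^ (3 + t * I))
    (∑' n : ℕ, 1 / (((n + 1 : ℕ) : ℂ) + 1) ^ (3 + t * I))
  have h1 : ‖1 / (((0 : ℕ) : ℂ) + 1) ^ (3 + t * I)‖ = 1 := by simp
  linarith

theorem exists_card_zetaZeros_le :
    ∃ K : ℝ, 0 ≤ K ∧ ∀ (t : ℝ) (T : Finset ℂ),
      (∀ z ∈ T, z ∈ zetaZeros ∧ |z.im - t| ≤ 1) →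
      (T.card : ℝ) ≤ K * (1 + |t|) := by
  obtain ⟨M₀, hM₀⟩ := exists_norm_completedRiemannZeta₀_le (-2) 8
  obtain ⟨k₁, hk₁, hG⟩ := exists_le_norm_Gammaℝ_three_add
  obtain ⟨k₂, hk₂, hZ⟩ := exists_le_norm_riemannZeta_three_add
  set M := max M₀ 0
  have hM : ∀ s : ℂ, -2 ≤ s.re → s.re ≤ 8 → ‖completedRiemannZeta₀ s‖ ≤ M :=
    fun s h₁ h₂ => (hM₀ s h₁ h₂).trans (le_max_left _ _)
  have hM0 : 0 ≤ M := le_max_right _ _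
  set f : ℂ → ℂ := fun s => s * (1 - s) * completedRiemannZeta₀ s - 1 with hf_def
  have hf : Differentiable ℂ f := by
    have := differentiable_completedZeta₀
    fun_prop
  have hfΛ : ∀ s : ℂ, s ≠ 0 → s ≠ 1 → f s = s * (1 - s) * completedRiemannZeta s := by
    intro s h0 h1
    have h1' : 1 - s ≠ 0 := sub_ne_zero.2 h1.symm
    rw [completedRiemannZeta_eq, hf_def]
    field_simp
    ring
  have hΛζ : ∀ s : ℂ, 0 < s.re → completedRiemannZeta s = riemannZeta s * Gammaℝ s := by
    intro s hs
    have h0 : s ≠ 0 := by rintro rfl; simp at hs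
    rw [riemannZeta_def_of_ne_zero h0, div_mul_cancel₀ _ (Gammaℝ_ne_zero_of_re_pos hs)]
  set L : ℝ := Real.log (5 / 4)
  have hL : 0 < L := Real.log_pos (by norm_num)
  refine ⟨(M + 19 + |Real.log (k₁ * k₂)| + 3) / L, by positivity, fun t T hT => ?_⟩
  set c : ℂ := 3 + t * I with hc
  have hcre : c.re = 3 := by simp [hc]
  have hcim : c.im = t := by simp [hc]
  have hfc : k₁ * k₂ * Real.exp (-|t|) ≤ ‖f c‖ := by
    rw [hfΛ c (by intro h; simp [h] at hcre) (by intro h; simp [h] at hcre),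
      hΛζ c (by rw [hcre]; norm_num), norm_mul, norm_mul, norm_mul]
    have h1 : 1 ≤ ‖c‖ := by
      refine le_trans ?_ (Complex.re_le_norm c); rw [hcre]; norm_num
    have h2 : 1 ≤ ‖1 - c‖ := by
      refine le_trans ?_ (Complex.abs_re_le_norm _); simp [hcre]; norm_num
    have h3 : k₂ * (k₁ * Real.exp (-|t|)) ≤ ‖riemannZeta c‖ * ‖Gammaℝ c‖ :=
      mul_le_mul (hZ t) (hG t) (by positivity) (norm_nonneg _)
    have h4 : 1 * 1 ≤ ‖c‖ * ‖1 - c‖ := mul_le_mul h1 h2 zero_le_one (norm_nonneg _)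
    nlinarith [norm_nonneg (riemannZeta c), norm_nonneg (Gammaℝ c),
      mul_nonneg (norm_nonneg (riemannZeta c)) (norm_nonneg (Gammaℝ c))]
  have hfcpos : 0 < ‖f c‖ := lt_of_lt_of_le (by positivity) hfc
  have hcn : ‖c‖ ≤ 3 + |t| := by
    refine (norm_add_le _ _).trans ?_
    simp
  have hbound : ∀ z ∈ Metric.sphere c 5, ‖f z‖ ≤ (M + 1) * (|t| + 9) ^ 2 := by
    intro z hz
    have hz' : ‖z - c‖ = 5 := by simpa [dist_eq_norm] using hz
    have hre := Complex.abs_re_le_norm (z - c)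
    rw [hz', Complex.sub_re, hcre, abs_le] at hre
    have hzn : ‖z‖ ≤ |t| + 9 := by
      have := norm_add_le (z - c) c
      rw [sub_add_cancel] at this
      linarith
    have hzn' : ‖1 - z‖ ≤ |t| + 9 := by
      have h1 := norm_sub_le (1 : ℂ) z
      have h2 := norm_add_le (z - c) c
      rw [sub_add_cancel] at h2
      rw [norm_one] at h1
      linarith
    have hMz := hM z (by linarith) (by linarith)
    calc ‖f z‖ ≤ ‖z * (1 - z) * completedRiemannZeta₀ z‖ + ‖(1 : ℂ)‖ := norm_sub_le _ _
      _ ≤ (|t| + 9) * (|t| + 9) * M + 1 := by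
        rw [norm_mul, norm_mul, norm_one]; gcongr
      _ ≤ _ := by nlinarith [abs_nonneg t]
  have hbig : 1 ≤ (M + 1) * (|t| + 9) ^ 2 := by nlinarith [abs_nonneg t]
  have key := AnalyticOnNhd.card_zeros_le (c := c) (r := 4) (R := 5) (f := f) (by norm_num)
    (by norm_num) hbig (fun z _ => hf.analyticAt z) (norm_pos_iff.1 hfcpos) hbound T (by
      intro z hz
      obtain ⟨⟨hz0, hz1, hz2⟩, hz3⟩ := hT z hz
      constructor
      · rw [Metric.mem_closedBall, dist_eq_norm]
        refine (Complex.norm_le_abs_re_add_abs_im _).trans ?_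
        rw [Complex.sub_re, Complex.sub_im, hcre, hcim]
        have : |z.re - 3| ≤ 3 := by rw [abs_le]; constructor <;> linarith
        linarith
      · rw [hfΛ z (by rintro rfl; simp at hz1) (by rintro rfl; simp at hz2), hΛζ z hz1, hz0]
        simp)
  refine key.trans ?_
  rw [div_mul_eq_mul_div]
  gcongr
  rw [Real.log_div (by positivity) hfcpos.ne', Real.log_mul (by positivity) (by positivity),
    Real.log_pow]
  have e1 := Real.log_le_sub_one_of_pos (show 0 < M + 1 by positivity)
  have e2 := Real.log_le_sub_one_of_pos (show 0 < |t| + 9 by positivity)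
  have e3 := Real.log_le_log (by positivity) hfc
  rw [Real.log_mul (by positivity) (Real.exp_pos _).ne', Real.log_exp] at e3
  have e4 := neg_abs_le (Real.log (k₁ * k₂))
  push_cast
  have := abs_nonneg t
  nlinarith [abs_nonneg (Real.log (k₁ * k₂)),
    mul_nonneg (abs_nonneg (Real.log (k₁ * k₂))) this, mul_nonneg hM0 this]

theorem summable_one_add_abs_mul_exp_neg_abs {b : ℝ} (hb : 0 < b) :
    Summable fun n : ℤ => (1 + |(n : ℝ)|) * Real.exp (-b * |(n : ℝ)|) := by
  have h : Summable fun n : ℕ => (1 + (n : ℝ)) * Real.exp (-b * n) := by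
    have h0 := Real.summable_pow_mul_exp_neg_nat_mul 0 hb
    have h1 := Real.summable_pow_mul_exp_neg_nat_mul 1 hb
    simpa [add_mul] using h0.add h1
  rw [summable_int_iff_summable_nat_and_neg]
  constructor <;> simpa using h

theorem summable_exp_neg_abs_im_zetaZeros {b : ℝ} (hb : 0 < b) :
    Summable fun ρ : zetaZeros => Real.exp (-b * |(ρ : ℂ).im|) := by
  classical
  obtain ⟨K, hK, hcard⟩ := exists_card_zetaZeros_le
  have hs := (summable_one_add_abs_mul_exp_neg_abs hb).mul_left (K * Real.exp b)
  refine summable_of_sum_le (c := ∑' n : ℤ, K * Real.exp b *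
    ((1 + |(n : ℝ)|) * Real.exp (-b * |(n : ℝ)|))) (fun _ => (Real.exp_pos _).le) fun u => ?_
  rw [← Finset.sum_fiberwise_of_maps_to (t := u.image fun ρ : zetaZeros => ⌊(ρ : ℂ).im⌋)
    (g := fun ρ : zetaZeros => ⌊(ρ : ℂ).im⌋) (fun ρ hρ => Finset.mem_image_of_mem _ hρ)]
  refine (Finset.sum_le_sum fun n _ => ?_).trans
    (hs.sum_le_tsum _ fun n _ => by positivity)
  set F := u.filter fun ρ : zetaZeros => ⌊(ρ : ℂ).im⌋ = n
  have hF : ∀ ρ ∈ F, |(ρ : ℂ).im - n| ≤ 1 := by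
    intro ρ hρ
    have hn : ⌊(ρ : ℂ).im⌋ = n := (Finset.mem_filter.1 hρ).2
    have h1 := Int.floor_le (ρ : ℂ).im
    have h2 := Int.lt_floor_add_one (ρ : ℂ).im
    rw [hn] at h1 h2
    rw [abs_le]; constructor <;> linarith
  have hc := hcard n (F.map (Function.Embedding.subtype _)) (by
    intro z hz
    obtain ⟨ρ, hρ, rfl⟩ := Finset.mem_map.1 hz
    exact ⟨ρ.2, hF ρ hρ⟩)
  rw [Finset.card_map] at hc
  calc ∑ ρ ∈ F, Real.exp (-b * |(ρ : ℂ).im|)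
      ≤ ∑ ρ ∈ F, Real.exp b * Real.exp (-b * |(n : ℝ)|) := by
        refine Finset.sum_le_sum fun ρ hρ => ?_
        rw [← Real.exp_add]
        apply Real.exp_le_exp.2
        have h1 := hF ρ hρ
        have h2 := abs_sub_abs_le_abs_sub (n : ℝ) (ρ : ℂ).im
        rw [abs_sub_comm] at h2
        nlinarith
    _ = F.card * (Real.exp b * Real.exp (-b * |(n : ℝ)|)) := by simp
    _ ≤ K * (1 + |(n : ℝ)|) * (Real.exp b * Real.exp (-b * |(n : ℝ)|)) := by gcongr
    _ = _ := by ring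

theorem summable_abs_im_rpow_mul_exp_zetaZeros :
    Summable fun ρ : zetaZeros => |(ρ : ℂ).im| ^ ((ρ : ℂ).re - 1 / 2) *
      Real.exp (-(Real.pi / 4 * |(ρ : ℂ).im|)) := by
  refine Summable.of_norm_bounded_eventually
    ((summable_exp_neg_abs_im_zetaZeros (b := 1 / 2) (by norm_num)).mul_left 4) ?_
  have hfin : (Set.Icc (0 : ℝ) 1 ×ℂ Set.Icc (-1 : ℝ) 1 ∩ riemannZetaZeros).Finite :=
    (isCompact_Icc.reProdIm isCompact_Icc).inter_riemannZetaZeros_finite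
  rw [Filter.eventually_cofinite]
  refine Set.Finite.subset (hfin.preimage Subtype.val_injective.injOn) ?_
  rintro ⟨ρ, h0, h1, h2⟩ hρ
  by_contra hnot
  apply hρ
  have him : 1 < |ρ.im| := by
    by_contra! h
    exact hnot ⟨⟨⟨h1.le, h2.le⟩, abs_le.1 h⟩, h0⟩
  have hx := abs_nonneg ρ.im
  simp only
  rw [Real.norm_of_nonneg (by positivity)]
  have e1 : |ρ.im| ^ (ρ.re - 1 / 2) ≤ |ρ.im| := by
    have := Real.rpow_le_rpow_of_exponent_le him.le (show ρ.re - 1 / 2 ≤ 1 by linarith)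
    rwa [Real.rpow_one] at this
  have e2 : |ρ.im| ≤ 4 * Real.exp (|ρ.im| / 4) := by
    have := Real.add_one_le_exp (|ρ.im| / 4)
    linarith
  calc _ ≤ 4 * Real.exp (|ρ.im| / 4) * Real.exp (-(3 / 4 * |ρ.im|)) := by
        gcongr
        · exact e1.trans e2
        · exact Real.pi_gt_three.le
    _ = _ := by rw [mul_assoc, ← Real.exp_add]; congr 2; ring

theorem exists_abs_log_rpow_le {c ε : ℝ} (hc : 0 ≤ c) (hε : 0 < ε) :
    ∃ B : ℝ, 0 ≤ B ∧ ∀ u : ℝ, 1 ≤ u → |Real.log u| ^ c ≤ B * u ^ ε := by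
  have hδ : 0 < ε / (c + 1) := by positivity
  refine ⟨(1 / (ε / (c + 1))) ^ c, by positivity, fun u hu => ?_⟩
  have hu0 : 0 ≤ u := by linarith
  rw [abs_of_nonneg (Real.log_nonneg hu)]
  calc Real.log u ^ c ≤ (u ^ (ε / (c + 1)) / (ε / (c + 1))) ^ c :=
        Real.rpow_le_rpow (Real.log_nonneg hu) (Real.log_le_rpow_div hu0 hδ) hc
    _ = (1 / (ε / (c + 1))) ^ c * u ^ (ε / (c + 1) * c) := by
        rw [div_eq_mul_one_div, Real.mul_rpow (by positivity) (by positivity), ← Real.rpow_mul hu0,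
          mul_comm]
    _ ≤ _ := by
        gcongr
        rw [div_mul_eq_mul_div, div_le_iff₀ (by positivity)]
        nlinarith

theorem integrable_sqrt_one_add_sq_rpow_mul_abs_log_rpow {α c : ℝ} (hα : 1 < α) (hc : 0 ≤ c) :
    Integrable fun u : ℝ => √(1 + u ^ 2) ^ (-α) * |Real.log u| ^ c := by
  set h : ℝ → ℝ := fun u => √(1 + u ^ 2) ^ (-α) * |Real.log u| ^ c with hh
  have hmeas : Measurable h := by fun_prop
  have hnn : ∀ u, 0 ≤ h u := fun u => by positivity
  have hIoc : IntegrableOn h (Set.Ioc 0 1) := by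
    obtain ⟨B, hB, hlog⟩ := exists_abs_log_rpow_le hc (ε := 1 / 2) (by norm_num)
    have hi : IntegrableOn (fun u : ℝ => B * u ^ (-(1 / 2) : ℝ)) (Set.Ioc 0 1) := by
      refine Integrable.const_mul ?_ B
      exact (intervalIntegrable_iff_integrableOn_Ioc_of_le zero_le_one).1
        (intervalIntegral.intervalIntegrable_rpow' (by norm_num))
    refine Integrable.mono' hi hmeas.aestronglyMeasurable ?_
    refine (ae_restrict_iff' measurableSet_Ioc).2 (Filter.Eventually.of_forall ?_)
    intro u hu
    rw [Real.norm_of_nonneg (hnn u)]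
    have h1 := hlog u⁻¹ ((one_le_inv₀ hu.1).2 hu.2)
    rw [Real.log_inv, abs_neg, Real.inv_rpow hu.1.le, ← Real.rpow_neg hu.1.le] at h1
    have h2 : √(1 + u ^ 2) ^ (-α) ≤ 1 :=
      Real.rpow_le_one_of_one_le_of_nonpos (Real.one_le_sqrt.2 (by nlinarith)) (by linarith)
    calc h u ≤ 1 * |Real.log u| ^ c := by simp only [hh]; gcongr
      _ ≤ _ := by rwa [one_mul]
  have hIoi : IntegrableOn h (Set.Ioi 1) := by
    obtain ⟨B, hB, hlog⟩ := exists_abs_log_rpow_le hc (ε := (α - 1) / 2) (by linarith)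
    have hi : IntegrableOn (fun u : ℝ => B * u ^ ((α - 1) / 2 - α)) (Set.Ioi 1) :=
      Integrable.const_mul (integrableOn_Ioi_rpow_of_lt (by linarith) one_pos) B
    refine Integrable.mono' hi hmeas.aestronglyMeasurable ?_
    refine (ae_restrict_iff' measurableSet_Ioi).2 (Filter.Eventually.of_forall ?_)
    intro u hu
    have hu0 : (0 : ℝ) < u := zero_lt_one.trans hu
    rw [Real.norm_of_nonneg (hnn u)]
    have h1 := hlog u (le_of_lt hu)
    have h2 : √(1 + u ^ 2) ^ (-α) ≤ u ^ (-α) :=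
      Real.rpow_le_rpow_of_nonpos hu0 (Real.le_sqrt_of_sq_le (by linarith)) (by linarith)
    calc h u ≤ u ^ (-α) * (B * u ^ ((α - 1) / 2)) := by simp only [hh]; gcongr
      _ = _ := by rw [sub_eq_add_neg _ α, Real.rpow_add hu0]; ring
  have hpos : IntegrableOn h (Set.Ioi 0) := by
    rw [← Set.Ioc_union_Ioi_eq_Ioi (zero_le_one (α := ℝ))]
    exact hIoc.union hIoi
  have hneg : IntegrableOn h (Set.Iio 0) := by
    have := (Measure.measurePreserving_neg (volume : Measure ℝ)).integrableOn_comp_preimage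
      (Homeomorph.neg ℝ).measurableEmbedding (f := h) (s := Set.Ioi 0)
    have e : h ∘ Neg.neg = h := by
      ext u; simp [hh]
    rw [e] at this
    simpa using this.2 hpos
  rw [← integrableOn_univ, ← Set.Iic_union_Ioi (a := (0 : ℝ))]
  exact ((integrableOn_Iic_iff_integrableOn_Iio (by simp)).2 hneg).union hpos

theorem norm_add_mul_I_rpow_le {a α β : ℝ} (ha : a ∈ Set.Ioo (0 : ℝ) 1)
    (hβ : β ∈ Set.Ioo (0 : ℝ) 1) (y : ℝ) :
    ‖(a : ℂ) + y * I‖ ^ (-α - β) ≤ a ^ (-α - 1) * √(1 + (y / a) ^ 2) ^ (-α) := by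
  obtain ⟨ha0, ha1⟩ := ha
  have e : ‖(a : ℂ) + y * I‖ = a * √(1 + (y / a) ^ 2) := by
    rw [Complex.norm_add_mul_I, show a ^ 2 + y ^ 2 = a ^ 2 * (1 + (y / a) ^ 2) by field_simp,
      Real.sqrt_mul (sq_nonneg a), Real.sqrt_sq ha0.le]
  rw [e, Real.mul_rpow ha0.le (Real.sqrt_nonneg _)]
  have h1 : a ^ (-α - β) ≤ a ^ (-α - 1) :=
    Real.rpow_le_rpow_of_exponent_ge ha0 ha1.le (by linarith [hβ.2])
  have h2 : √(1 + (y / a) ^ 2) ^ (-α - β) ≤ √(1 + (y / a) ^ 2) ^ (-α) :=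
    Real.rpow_le_rpow_of_exponent_le (Real.one_le_sqrt.2 (by nlinarith [sq_nonneg (y / a)]))
      (by linarith [hβ.1])
  gcongr

theorem mul_arctan_sub_le {a γ y : ℝ} (ha : 0 < a) (hy : y ∈ Y1 γ ∪ Y2 γ a) :
    γ * Real.arctan (y / a) - Real.pi / 2 * |γ| ≤ -(Real.pi / 4 * |γ|) := by
  suffices γ * Real.arctan (y / a) ≤ Real.pi / 4 * |γ| by linarith
  have hπ := Real.pi_pos
  rcases hy with hy | ⟨⟨hy1, hy2⟩, -⟩
  · have hy' : γ * y ≤ 0 := hy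
    have : γ * Real.arctan (y / a) ≤ 0 := by
      rcases le_total 0 y with h0 | h0
      · have h1 : 0 ≤ Real.arctan (y / a) := Real.arctan_nonneg.2 (by positivity)
        rcases h0.eq_or_lt with rfl | h0
        · simp
        · exact mul_nonpos_of_nonpos_of_nonneg (by nlinarith) h1
      · have h1 : Real.arctan (y / a) ≤ 0 :=
          Real.arctan_zero ▸ Real.arctan_strictMono.monotone
            (div_nonpos_of_nonpos_of_nonneg h0 ha.le)
        rcases h0.eq_or_lt with rfl | h0
        · simp
        · exact mul_nonpos_of_nonneg_of_nonpos (by nlinarith) h1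
    exact this.trans (by positivity)
  · have h1 : |Real.arctan (y / a)| ≤ Real.pi / 4 := by
      rw [abs_le, ← Real.arctan_one, ← Real.arctan_neg]
      constructor <;> apply Real.arctan_strictMono.monotone
      · rw [le_div_iff₀ ha]; linarith
      · rw [div_le_iff₀ ha]; linarith
    calc _ ≤ |γ * Real.arctan (y / a)| := le_abs_self _
      _ = |Real.arctan (y / a)| * |γ| := by rw [abs_mul, mul_comm]
      _ ≤ _ := by gcongr

theorem norm_setIntegral_exp_arctan_le {α c a β γ : ℝ} (hα : 1 < α) (hc : 0 ≤ c)
    (ha : a ∈ Set.Ioo (0 : ℝ) 1) (hβ : β ∈ Set.Ioo (0 : ℝ) 1) :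
    ‖∫ y in Y1 γ ∪ Y2 γ a, Real.exp (γ * Real.arctan (y / a) - Real.pi / 2 * |γ|) *
        ‖(a : ℂ) + y * I‖ ^ (-α - β) * Real.log (|y| / a) ^ c‖ ≤
      Real.exp (-(Real.pi / 4 * |γ|)) *
        ((∫ u : ℝ, √(1 + u ^ 2) ^ (-α) * |Real.log u| ^ c) * a ^ (-α)) := by
  have ha0 := ha.1
  set h : ℝ → ℝ := fun u => √(1 + u ^ 2) ^ (-α) * |Real.log u| ^ c with hh
  have hnn : ∀ u, 0 ≤ h u := fun u => by positivity
  have hint : Integrable h := integrable_sqrt_one_add_sq_rpow_mul_abs_log_rpow hα hc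
  have hint' : Integrable fun y : ℝ =>
      Real.exp (-(Real.pi / 4 * |γ|)) * a ^ (-α - 1) * h (y / a) :=
    (hint.comp_div ha0.ne').const_mul _
  have hS : MeasurableSet (Y1 γ ∪ Y2 γ a) := by
    refine MeasurableSet.union ?_ (measurableSet_Icc.inter ?_)
    · exact measurableSet_le (measurable_const_mul γ) measurable_const
    · exact measurableSet_lt measurable_const (measurable_mul_const γ)
  refine (norm_integral_le_of_norm_le hint'.integrableOn
    ((ae_restrict_iff' hS).2 (Filter.Eventually.of_forall fun y hy => ?_))).trans ?_
  · rw [norm_mul, norm_mul, Real.norm_of_nonneg (Real.exp_pos _).le,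
      Real.norm_of_nonneg (Real.rpow_nonneg (norm_nonneg _) _), Real.norm_eq_abs]
    have h1 := Real.exp_le_exp.2 (mul_arctan_sub_le ha0 hy)
    have h2 := norm_add_mul_I_rpow_le (α := α) ha hβ y
    have h3 : |Real.log (|y| / a) ^ c| ≤ |Real.log (y / a)| ^ c := by
      refine (Real.abs_rpow_le_abs_rpow _ _).trans_eq ?_
      rw [← Real.log_abs (y / a), abs_div, abs_of_pos ha0]
    calc _ ≤ Real.exp (-(Real.pi / 4 * |γ|)) * (a ^ (-α - 1) * √(1 + (y / a) ^ 2) ^ (-α)) *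
          |Real.log (y / a)| ^ c := by gcongr
      _ = _ := by simp only [hh]; ring
  · refine (setIntegral_le_integral hint' (Filter.Eventually.of_forall fun y => ?_)).trans_eq ?_
    · have := hnn (y / a)
      simp only [Pi.zero_apply]
      positivity
    · rw [integral_const_mul, Measure.integral_comp_div h a, abs_of_pos ha0, smul_eq_mul,
        Real.rpow_sub ha0, Real.rpow_one]
      field_simp

theorem exists_summable_and_tsum_le (α : ℝ) (hα : 1 < α) (c : ℝ) (hc : 0 ≤ c) :
    ∃ C : ℝ, 0 < C ∧ ∀ a ∈ Set.Ioo (0 : ℝ) 1,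
      Summable (fun ρ : zetaZeros =>
        |(ρ : ℂ).im| ^ ((ρ : ℂ).re - 1 / 2) *
          ∫ y in Y1 (ρ : ℂ).im ∪ Y2 (ρ : ℂ).im a,
            Real.exp ((ρ : ℂ).im * Real.arctan (y / a) - Real.pi / 2 * |(ρ : ℂ).im|) *
              ‖(a : ℂ) + y * Complex.I‖ ^ (-α - (ρ : ℂ).re) * Real.log (|y| / a) ^ c) ∧
      (∑' ρ : zetaZeros,
          |(ρ : ℂ).im| ^ ((ρ : ℂ).re - 1 / 2) *
            ∫ y in Y1 (ρ : ℂ).im ∪ Y2 (ρ : ℂ).im a,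
              Real.exp ((ρ : ℂ).im * Real.arctan (y / a) - Real.pi / 2 * |(ρ : ℂ).im|) *
                ‖(a : ℂ) + y * Complex.I‖ ^ (-α - (ρ : ℂ).re) * Real.log (|y| / a) ^ c)
        ≤ C * a ^ (-α) := by
  set H := ∫ u : ℝ, √(1 + u ^ 2) ^ (-α) * |Real.log u| ^ c
  set w : zetaZeros → ℝ := fun ρ => |(ρ : ℂ).im| ^ ((ρ : ℂ).re - 1 / 2) *
    Real.exp (-(Real.pi / 4 * |(ρ : ℂ).im|)) with hw
  have hH : 0 ≤ H := integral_nonneg fun u => by positivity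
  have hw0 : 0 ≤ ∑' ρ, w ρ := tsum_nonneg fun ρ => by positivity
  refine ⟨(∑' ρ, w ρ) * H + 1, by positivity, fun a ha => ?_⟩
  have hsum : Summable fun ρ => w ρ * (H * a ^ (-α)) :=
    summable_abs_im_rpow_mul_exp_zetaZeros.mul_right _
  have hle : ∀ ρ : zetaZeros, ‖|(ρ : ℂ).im| ^ ((ρ : ℂ).re - 1 / 2) *
          ∫ y in Y1 (ρ : ℂ).im ∪ Y2 (ρ : ℂ).im a,
            Real.exp ((ρ : ℂ).im * Real.arctan (y / a) - Real.pi / 2 * |(ρ : ℂ).im|) *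
              ‖(a : ℂ) + y * Complex.I‖ ^ (-α - (ρ : ℂ).re) * Real.log (|y| / a) ^ c‖ ≤
      w ρ * (H * a ^ (-α)) := by
    intro ρ
    rw [norm_mul, Real.norm_of_nonneg (by positivity), hw, mul_assoc]
    gcongr
    exact norm_setIntegral_exp_arctan_le hα hc ha ρ.2.2
  refine ⟨Summable.of_norm_bounded hsum hle, ?_⟩
  refine (le_abs_self _).trans ((tsum_of_norm_bounded hsum.hasSum hle).trans ?_)
  rw [tsum_mul_right]
  have := Real.rpow_pos_of_pos ha.1 (-α)
  nlinarith

end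

/-- Lemma 5: `∑_ρ |γ|^{β-1/2} ∫_{Y₁∪Y₂} exp(γ arctan(y/a) - π|γ|/2) |z|^{-α-β} dy ≪_α a^{-α}`,
also with an inserted factor `log^c(|y|/a)`. -/
theorem zero_series_integral_bound (α : ℝ) (hα : 1 < α) :
    (∃ C : ℝ, 0 < C ∧ ∀ a ∈ Set.Ioo (0 : ℝ) 1,
      Summable (fun ρ : zetaZeros =>
        |(ρ : ℂ).im| ^ ((ρ : ℂ).re - 1 / 2) *
          ∫ y in Y1 (ρ : ℂ).im ∪ Y2 (ρ : ℂ).im a,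
            Real.exp ((ρ : ℂ).im * Real.arctan (y / a) - Real.pi / 2 * |(ρ : ℂ).im|) *
              ‖(a : ℂ) + y * Complex.I‖ ^ (-α - (ρ : ℂ).re)) ∧
      (∑' ρ : zetaZeros,
          |(ρ : ℂ).im| ^ ((ρ : ℂ).re - 1 / 2) *
            ∫ y in Y1 (ρ : ℂ).im ∪ Y2 (ρ : ℂ).im a,
              Real.exp ((ρ : ℂ).im * Real.arctan (y / a) - Real.pi / 2 * |(ρ : ℂ).im|) *
                ‖(a : ℂ) + y * Complex.I‖ ^ (-α - (ρ : ℂ).re))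
        ≤ C * a ^ (-α)) ∧
    (∀ c : ℝ, 0 ≤ c → ∃ C : ℝ, 0 < C ∧ ∀ a ∈ Set.Ioo (0 : ℝ) 1,
      Summable (fun ρ : zetaZeros =>
        |(ρ : ℂ).im| ^ ((ρ : ℂ).re - 1 / 2) *
          ∫ y in Y1 (ρ : ℂ).im ∪ Y2 (ρ : ℂ).im a,
            Real.exp ((ρ : ℂ).im * Real.arctan (y / a) - Real.pi / 2 * |(ρ : ℂ).im|) *
              ‖(a : ℂ) + y * Complex.I‖ ^ (-α - (ρ : ℂ).re) * Real.log (|y| / a) ^ c) ∧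
      (∑' ρ : zetaZeros,
          |(ρ : ℂ).im| ^ ((ρ : ℂ).re - 1 / 2) *
            ∫ y in Y1 (ρ : ℂ).im ∪ Y2 (ρ : ℂ).im a,
              Real.exp ((ρ : ℂ).im * Real.arctan (y / a) - Real.pi / 2 * |(ρ : ℂ).im|) *
                ‖(a : ℂ) + y * Complex.I‖ ^ (-α - (ρ : ℂ).re) * Real.log (|y| / a) ^ c)
        ≤ C * a ^ (-α)) := by
  refine ⟨?_, exists_summable_and_tsum_le α hα⟩
  simpa only [Real.rpow_zero, mul_one] using exists_summable_and_tsum_le α hα 0 le_rfl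

end
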